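/- Let $R$ be an integral domain which is a smooth finitely generated $\mathbb{C}$-algebra (the coordinate ring of a nonsingular affine complex variety), and let $I_X \subsetneq R$ be a radical ideal generated by elements $f_1,\dots,f_t$ such that every minimal prime over $I_X$ has height $c$, where $c \geq 1$. Then there exists a nonzero polynomial $P \in \mathbb{C}[y_{i,j} : 1 \le i \le c,\ 1 \le j \le t]$ such that for every matrix $(a_{i,j}) \in \mathbb{C}^{c \times t}$ with $P((a_{i,j})) \neq 0$ the following holds: setting $\alpha_i := a_{i,1}f_1 + \dots + a_{i,t}f_t$ for $i = 1,\dots,c$, $I_V := (\alpha_1,\dots,\alpha_c)$ and $I_Y := (I_V :_R I_X)$, if $I_Y \neq R$ then $\alpha_1,\dots,\alpha_c$ is a regular sequence in $R$, $I_Y$ is a radical ideal, every associated prime of $R/I_Y$ is a minimal prime over $I_Y$ and has height $c$, and $I_V = I_X \cap I_Y$. -/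

import Mathlib

universe u

section

open IsLocalRing RingTheory.Sequence

/-- Localizations of an étale algebra over a regular ring are regular local rings. -/
theorem isRegularLocalRing_localization_of_etale {P T : Type*} [CommRing P] [CommRing T]
    [Algebra P T] [IsRegularRing P] [Algebra.Etale P T] (p : Ideal T) [p.IsPrime] :
    IsRegularLocalRing (Localization.AtPrime p) := by
  have : IsNoetherianRing T := Algebra.FiniteType.isNoetherianRing P T
  let q := p.under P
  have : p.LiesOver q := ⟨rfl⟩
  let := Localization.AtPrime.algebraOfLiesOver q p
  have : Algebra.FormallyUnramified T (Localization.AtPrime p) :=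
    .of_isLocalization p.primeCompl
  have : Algebra.FormallyUnramified P (Localization.AtPrime p) := .comp _ T _
  have h1 := (Algebra.isUnramifiedAt_iff_map_eq P q p).mp inferInstance
  have h2 := (IsRegularRing.isRegularLocalRing_localization q).spanFinrank_maximalIdeal
  have h3 : maximalIdeal (Localization.AtPrime p) =
      (maximalIdeal (Localization.AtPrime q)).map (algebraMap _ (Localization.AtPrime p)) := by
    rw [← h1.2, ← Localization.AtPrime.map_eq_maximalIdeal, Ideal.map_map,
      ← IsScalarTower.algebraMap_eq]
  have h4 := Ideal.height_eq_height_add_of_liesOver_of_hasGoingDown q p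
  apply IsRegularLocalRing.of_spanFinrank_maximalIdeal_le
  rw [h3, IsLocalization.AtPrime.ringKrullDim_eq_height p]
  rw [IsLocalization.AtPrime.ringKrullDim_eq_height q] at h2
  have h5 := Ideal.spanFinrank_map_le_of_fg (algebraMap _ (Localization.AtPrime p))
    (IsNoetherian.noetherian (maximalIdeal (Localization.AtPrime q)))
  calc _ ≤ (((maximalIdeal (Localization.AtPrime q)).spanFinrank : ℕ) : WithBot ℕ∞) := by
        exact_mod_cast h5
    _ = q.height := h2
    _ ≤ p.height := by
        rw [h4]
        exact_mod_cast le_self_add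

/-- A smooth algebra over a field has regular local rings. -/
theorem isRegularLocalRing_localization_of_smooth (k : Type*) {T : Type*} [Field k] [CommRing T]
    [Algebra k T] [Algebra.Smooth k T] (p : Ideal T) [p.IsPrime] :
    IsRegularLocalRing (Localization.AtPrime p) := by
  have : Algebra.IsSmoothAt k p := by
    have := (Set.ext_iff.mp (Algebra.smoothLocus_eq_univ (R := k) (A := T)) ⟨p, ‹_›⟩).mpr trivial
    exact this
  obtain ⟨f, hf, n, _, _, h⟩ :=
    Algebra.IsSmoothAt.exists_isStandardEtale_mvPolynomial (R := k) (p := p)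
  have hdisj : Disjoint (Submonoid.powers f : Set T) p :=
    (Ideal.disjoint_powers_iff_notMem _ (Ideal.IsPrime.isRadical ‹_›)).mpr hf
  let p' := p.map (algebraMap T (Localization.Away f))
  have hp' : p'.IsPrime :=
    IsLocalization.isPrime_of_isPrime_disjoint (Submonoid.powers f) _ p ‹_› hdisj
  have hcomap : p'.under T = p :=
    IsLocalization.under_map_of_isPrime_disjoint (Submonoid.powers f) _ ‹_› hdisj
  have hreg := isRegularLocalRing_localization_of_etale (P := MvPolynomial (Fin n) k) p'
  have := IsLocalization.isLocalization_isLocalization_atPrime_isLocalization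
    (Submonoid.powers f) (Localization.AtPrime p') p'
  have : IsLocalization.AtPrime (Localization.AtPrime p') p := by
    convert this
    exact hcomap.symm
  exact IsRegularLocalRing.of_ringEquiv
    (IsLocalization.algEquiv p.primeCompl (Localization.AtPrime p')
      (Localization.AtPrime p)).toRingEquiv

theorem spanFinrank_maximalIdeal_quotient_le {R : Type*} [CommRing R] [IsLocalRing R]
    [IsNoetherianRing R] {d : ℕ} (hd : (maximalIdeal R).spanFinrank = d + 1) {x : R}
    (hx : x ∈ maximalIdeal R) (hx2 : x ∉ maximalIdeal R ^ 2) [IsLocalRing (R ⧸ Ideal.span {x})] :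
    (maximalIdeal (R ⧸ Ideal.span {x})).spanFinrank ≤ d := by
  classical
  have hfg : (maximalIdeal R).FG := IsNoetherian.noetherian _
  obtain ⟨s, hs, hcard⟩ : ∃ s : Finset R, Ideal.span (s : Set R) = maximalIdeal R ∧
      s.card = d + 1 := by
    refine ⟨(Submodule.FG.finite_generators hfg).toFinset, ?_, ?_⟩
    · rw [Set.Finite.coe_toFinset]; exact Submodule.span_generators _
    · rw [← hd, ← Submodule.FG.generators_ncard hfg,
        Set.ncard_eq_toFinset_card _ (Submodule.FG.finite_generators hfg)]
  have hxs := hx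
  rw [← hs, Ideal.span, Submodule.mem_span_finset] at hxs
  obtain ⟨r, -, hr⟩ := hxs
  obtain ⟨i, his, hi⟩ : ∃ i ∈ s, r i ∉ maximalIdeal R := by
    by_contra! h
    apply hx2
    rw [← hr, pow_two]
    exact Ideal.sum_mem _ fun i hi ↦ Ideal.mul_mem_mul (h i hi) (hs ▸ Ideal.subset_span hi)
  let π := Ideal.Quotient.mk (Ideal.span {x})
  have hπ : Function.Surjective π := Ideal.Quotient.mk_surjective
  have hle : maximalIdeal (R ⧸ Ideal.span {x}) = Ideal.span ((s.erase i).image π) := by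
    have h1 : maximalIdeal (R ⧸ Ideal.span {x}) = (maximalIdeal R).map π :=
      (IsLocalRing.map_maximalIdeal_of_surjective π hπ).symm
    rw [h1, ← hs, Finset.coe_image, ← Ideal.map_span]
    apply le_antisymm _ (Ideal.map_mono (Ideal.span_mono (by simp)))
    rw [Ideal.map_le_iff_le_comap, Ideal.span_le]
    intro y hy
    by_cases hyi : y = i
    · subst hyi
      have hu : IsUnit (r y) := by simpa using hi
      have hsum : r y * y = x - ∑ j ∈ s.erase y, r j * j := by
        rw [← hr, ← Finset.add_sum_erase s _ his]; simp
      have : π (r y * y) ∈ Ideal.map π (Ideal.span ((s.erase y : Finset R) : Set R)) := by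
        rw [hsum, map_sub, (Ideal.Quotient.eq_zero_iff_mem.mpr (Ideal.mem_span_singleton_self x) :
          π x = 0), zero_sub]
        exact neg_mem (Ideal.mem_map_of_mem _ (Ideal.sum_mem _ fun j hj ↦
          Ideal.mul_mem_left _ _ (Ideal.subset_span hj)))
      rw [map_mul] at this
      exact (Ideal.unit_mul_mem_iff_mem _ (hu.map π)).mp this
    · exact Ideal.mem_map_of_mem _ (Ideal.subset_span (by simp [hyi, Finset.mem_coe.mp hy]))
  rw [hle]
  refine (Submodule.spanFinrank_span_le_ncard_of_finite (Finset.finite_toSet _)).trans ?_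
  rw [Set.ncard_coe_finset]
  refine Finset.card_image_le.trans ?_
  rw [Finset.card_erase_of_mem his, hcard, Nat.add_sub_cancel]

/-- A regular local ring is a domain, and its maximal ideal contains a regular sequence
whose length is the dimension. -/
theorem IsRegularLocalRing.isDomain_and_exists_isWeaklyRegular (d : ℕ) :
    ∀ (R : Type*) [CommRing R] [IsRegularLocalRing R], (maximalIdeal R).spanFinrank = d →
    IsDomain R ∧ ∃ rs : List R, rs.length = d ∧ (∀ r ∈ rs, r ∈ maximalIdeal R) ∧
      IsWeaklyRegular R rs := by
  induction d with
  | zero =>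
    intro R _ _ hd
    rw [Submodule.spanFinrank_eq_zero_iff_eq_bot (IsNoetherian.noetherian _)] at hd
    have := (IsLocalRing.isField_iff_maximalIdeal_eq.mpr hd)
    exact ⟨this.isDomain, [], by simp⟩
  | succ d ih =>
    intro R _ _ hd
    have hdim : ringKrullDim R = (d + 1 : ℕ) := by
      rw [← hd, IsRegularLocalRing.spanFinrank_maximalIdeal]
    obtain ⟨x, hx, hx2, hxmin⟩ : ∃ x ∈ maximalIdeal R, x ∉ maximalIdeal R ^ 2 ∧
        ∀ p ∈ minimalPrimes R, x ∉ p := by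
      by_contra! h
      have hfin : (minimalPrimes R).Finite := minimalPrimes.finite_of_isNoetherianRing R
      have := (Ideal.subset_union_prime' (s := hfin.toFinset) (f := fun i : Ideal R ↦ i)
        (a := maximalIdeal R ^ 2) (b := maximalIdeal R ^ 2) (I := maximalIdeal R) (fun p hp ↦ by
          simp only [Set.Finite.mem_toFinset] at hp; exact hp.1.1)).mp (by
          intro y hy
          by_cases hy2 : y ∈ maximalIdeal R ^ 2
          · exact Or.inl (Or.inl hy2)
          · obtain ⟨p, hp, hyp⟩ := h y hy hy2
            exact Or.inr (by simpa using ⟨p, hp, hyp⟩))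
      have hm2 : ¬ maximalIdeal R ≤ maximalIdeal R ^ 2 := by
        intro hle
        have : maximalIdeal R = ⊥ := Submodule.eq_bot_of_le_smul_of_le_jacobson_bot _ _
          (IsNoetherian.noetherian _) (by rwa [smul_eq_mul, ← pow_two])
          (IsLocalRing.maximalIdeal_le_jacobson _)
        rw [this] at hd
        simp at hd
      rcases this with h' | h' | ⟨p, hp, hmp⟩
      · exact hm2 h'
      · exact hm2 h'
      · simp only [Set.Finite.mem_toFinset] at hp
        have hp' : p.IsPrime := hp.1.1
        have : maximalIdeal R = p := le_antisymm hmp (IsLocalRing.le_maximalIdeal hp'.ne_top)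
        have h0 : (maximalIdeal R).height = 0 := by
          rw [this]
          exact Ideal.height_eq_zero_iff.mpr hp
        have := IsLocalRing.maximalIdeal_height_eq_ringKrullDim (R := R)
        rw [h0, hdim] at this
        norm_cast at this
    have hne : Ideal.span {x} ≠ ⊤ := fun h ↦ by
      rw [Ideal.span_singleton_eq_top] at h; exact hx h
    have : Nontrivial (R ⧸ Ideal.span {x}) := Ideal.Quotient.nontrivial_iff.mpr hne
    have : IsLocalRing (R ⧸ Ideal.span {x}) :=
      .of_surjective' (Ideal.Quotient.mk _) Ideal.Quotient.mk_surjective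
    have hspan := spanFinrank_maximalIdeal_quotient_le hd hx hx2
    have hdim' : (d : WithBot ℕ∞) ≤ ringKrullDim (R ⧸ Ideal.span {x}) := by
      have := ringKrullDim_le_ringKrullDim_quotient_add_card {x} (by
        rw [IsLocalRing.ringJacobson_eq_maximalIdeal]; simpa using hx)
      rw [hdim] at this
      simp only [Finset.card_singleton] at this
      push_cast at this
      rw [Finset.coe_singleton] at this
      exact ENat.WithBot.add_le_add_one_right_iff.mp this
    have hreg : IsRegularLocalRing (R ⧸ Ideal.span {x}) := .of_spanFinrank_maximalIdeal_le _
      ((Nat.cast_le.mpr hspan).trans hdim')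
    have hd' : (maximalIdeal (R ⧸ Ideal.span {x})).spanFinrank = d := by
      refine le_antisymm hspan ?_
      rw [← hreg.spanFinrank_maximalIdeal] at hdim'
      exact_mod_cast hdim'
    obtain ⟨hdom, rs, hlen, hmem, hrs⟩ := ih _ hd'
    have hxprime : (Ideal.span {x}).IsPrime := (Ideal.Quotient.isDomain_iff_prime _).mp hdom
    obtain ⟨p, hp, hpx⟩ := Ideal.exists_minimalPrimes_le (I := ⊥) (J := Ideal.span {x}) bot_le
    have hxp : x ∉ p := hxmin p hp
    have hp' : p.IsPrime := hp.1.1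
    have hpbot : p = ⊥ := by
      refine Submodule.eq_bot_of_le_smul_of_le_jacobson_bot (Ideal.span {x}) p
        (IsNoetherian.noetherian _) (fun y hy ↦ ?_)
        ((IsLocalRing.le_maximalIdeal hne).trans (IsLocalRing.maximalIdeal_le_jacobson _))
      obtain ⟨z, rfl⟩ := Ideal.mem_span_singleton.mp (hpx hy)
      exact Ideal.mul_mem_mul (Ideal.mem_span_singleton_self x)
        ((hp'.mem_or_mem hy).resolve_left hxp)
    have hdomR : IsDomain R := by
      rw [hpbot] at hp'
      exact IsDomain.of_bot_isPrime R
    refine ⟨hdomR, ?_⟩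
    obtain ⟨rs', rfl⟩ := (List.map_surjective_iff.mpr
      (Ideal.Quotient.mk_surjective (I := Ideal.span {x}))) rs
    refine ⟨x :: rs', by simpa using hlen, ?_, ?_⟩
    · simp only [List.mem_cons, forall_eq_or_imp]
      refine ⟨hx, fun r hr ↦ ?_⟩
      have := hmem _ (List.mem_map_of_mem hr)
      rw [mem_maximalIdeal, mem_nonunits_iff] at this ⊢
      exact fun h ↦ this (h.map _)
    · rw [isWeaklyRegular_cons_iff]
      have hx0 : x ≠ 0 := fun h ↦ hx2 (h ▸ zero_mem _)
      refine ⟨(IsRegular.of_ne_zero hx0).left.isSMulRegular, ?_⟩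
      have e : QuotSMulTop x R ≃ₗ[R] R ⧸ Ideal.span {x} :=
        Submodule.quotEquivOfEq _ _ (by
          simp [← Submodule.ideal_span_singleton_smul])
      rw [e.isWeaklyRegular_congr]
      exact (isWeaklyRegular_map_algebraMap_iff (R ⧸ Ideal.span {x}) _ rs').mp hrs

end

section

open IsLocalRing RingTheory.Sequence CategoryTheory Abelian Limits

open Pointwise in
theorem subsingleton_linearMap_quotient_of_subsingleton_ext {R : Type u} [CommRing R]
    (N : ModuleCat.{u} R) (rs : List R) : ∀ (M : ModuleCat.{u} R), IsWeaklyRegular M rs →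
    (∀ i ≤ rs.length, Subsingleton (Ext N M i)) →
    Subsingleton (N →ₗ[R] M ⧸ (Ideal.ofList rs • ⊤ : Submodule R M)) := by
  induction rs with
  | nil =>
    intro M _ h
    have : Subsingleton (N ⟶ M) := Ext.addEquiv₀.subsingleton_congr.mp (h 0 le_rfl)
    have : Subsingleton (N →ₗ[R] M) := ModuleCat.homAddEquiv.symm.subsingleton
    have e : (M ⧸ (Ideal.ofList [] • ⊤ : Submodule R M)) ≃ₗ[R] M :=
      Submodule.quotEquivOfEqBot _ (by
        rw [show Ideal.ofList ([] : List R) = ⊥ by simp]; exact Submodule.bot_smul _)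
    exact (LinearEquiv.congrRight e).toEquiv.subsingleton
  | cons x rs ih =>
    intro M hreg h
    rw [isWeaklyRegular_cons_iff] at hreg
    have := ih (ModuleCat.of R (QuotSMulTop x M)) hreg.2 (fun i hi ↦ by
      have zero1 := AddCommGrpCat.isZero_of_iff_subsingleton.mpr (h i (by simp; omega))
      have zero2 := AddCommGrpCat.isZero_of_iff_subsingleton.mpr (h (i + 1) (by simp; omega))
      exact AddCommGrpCat.subsingleton_of_isZero <| ShortComplex.Exact.isZero_of_both_zeros
        ((Ext.covariant_sequence_exact₃' N hreg.1.smulShortComplex_shortExact) i (i + 1) rfl)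
        (zero1.eq_zero_of_src _) (zero2.eq_zero_of_tgt _))
    exact (LinearEquiv.congrRight
      (Submodule.quotOfListConsSMulTopEquivQuotSMulTopInner M x rs)).toEquiv.subsingleton

/-- In a regular local ring the maximal ideal is not associated to the quotient by a regular
sequence shorter than the dimension. -/
theorem IsRegularLocalRing.eq_zero_of_maximalIdeal_smul_eq_zero {S : Type u} [CommRing S]
    [IsRegularLocalRing S] (rs : List S) (hrs : IsWeaklyRegular S rs)
    (hlen : rs.length < (maximalIdeal S).spanFinrank) (x : S)
    (hx : ∀ r ∈ maximalIdeal S, r * x ∈ Ideal.ofList rs) : x ∈ Ideal.ofList rs := by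
  obtain ⟨-, ss, hss, hmem, hreg⟩ :=
    IsRegularLocalRing.isDomain_and_exists_isWeaklyRegular _ S rfl
  have hlt : maximalIdeal S • (⊤ : Submodule S S) < ⊤ := by
    rw [smul_eq_mul, Ideal.mul_top]
    exact lt_top_iff_ne_top.mpr (Ideal.IsPrime.ne_top inferInstance)
  have hext := ModuleCat.subsingleton_ext_of_exists_isRegular (maximalIdeal S)
    (ModuleCat.of S (S ⧸ maximalIdeal S)) (by
      rw [Module.support_eq_zeroLocus, Ideal.annihilator_quotient]) (ModuleCat.of S S) hlt ss hmem
      (IsRegular.of_isWeaklyRegular_of_mem_maximalIdeal _ hmem hreg)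
  have := subsingleton_linearMap_quotient_of_subsingleton_ext
    (ModuleCat.of S (S ⧸ maximalIdeal S)) rs (ModuleCat.of S S) hrs
    (fun i hi ↦ hext i (by omega))
  have hbot : (Ideal.ofList rs • ⊤ : Submodule S S) = Ideal.ofList rs := by
    rw [smul_eq_mul, Ideal.mul_top]
  let g : S →ₗ[S] S ⧸ (Ideal.ofList rs • ⊤ : Submodule S S) :=
    (Submodule.mkQ _).comp (LinearMap.toSpanSingleton S S x)
  let φ : (S ⧸ maximalIdeal S) →ₗ[S] S ⧸ (Ideal.ofList rs • ⊤ : Submodule S S) :=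
    Submodule.liftQ _ g (fun r hr ↦ by
      simp only [g, LinearMap.mem_ker, LinearMap.comp_apply, LinearMap.toSpanSingleton_apply,
        Submodule.mkQ_apply, Submodule.Quotient.mk_eq_zero, hbot]
      exact hx r hr)
  have h0 : φ (Submodule.Quotient.mk 1) = 0 := by
    rw [Subsingleton.elim φ 0]; rfl
  rw [Submodule.liftQ_apply] at h0
  simpa only [g, LinearMap.comp_apply, LinearMap.toSpanSingleton_apply, one_smul,
    Submodule.mkQ_apply, Submodule.Quotient.mk_eq_zero, hbot] using h0

/-- Unmixedness: associated primes of the quotient by a regular sequence have height at most its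
length. -/
theorem height_le_length_of_mem_associatedPrimes {R : Type u} [CommRing R] [IsNoetherianRing R]
    (Q : Ideal R) [Q.IsPrime] [IsRegularLocalRing (Localization.AtPrime Q)] (rs : List R)
    (hrs : IsWeaklyRegular R rs) (x : R) (hQ : ∀ r, r ∈ Q ↔ r * x ∈ Ideal.ofList rs) :
    Q.height ≤ rs.length := by
  by_contra! hlt
  let S := Localization.AtPrime Q
  have hspan : rs.length < (maximalIdeal S).spanFinrank := by
    have h := IsRegularLocalRing.spanFinrank_maximalIdeal (R := S)
    rw [IsLocalization.AtPrime.ringKrullDim_eq_height Q] at h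
    have h' : ((maximalIdeal S).spanFinrank : ℕ∞) = Q.height := by exact_mod_cast h
    rw [← h'] at hlt
    exact_mod_cast hlt
  have hmap : Ideal.ofList (rs.map (algebraMap R S)) = (Ideal.ofList rs).map (algebraMap R S) :=
    (Ideal.map_ofList _ _).symm
  have hrs' : IsWeaklyRegular S (rs.map (algebraMap R S)) := hrs.of_flat
  have := IsRegularLocalRing.eq_zero_of_maximalIdeal_smul_eq_zero _ hrs' (by simpa using hspan)
    (algebraMap R S x) (fun r hr ↦ by
      rw [hmap]
      rw [← Localization.AtPrime.map_eq_maximalIdeal] at hr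
      have : Ideal.map (algebraMap R S) Q * Ideal.span {algebraMap R S x} ≤
          (Ideal.ofList rs).map (algebraMap R S) := by
        rw [← Set.image_singleton, ← Ideal.map_span, ← Ideal.map_mul]
        refine Ideal.map_mono (Ideal.mul_le.mpr fun a ha b hb ↦ ?_)
        obtain ⟨c, rfl⟩ := Ideal.mem_span_singleton'.mp hb
        rw [mul_left_comm]
        exact Ideal.mul_mem_left _ _ ((hQ a).mp ha)
      exact this (Ideal.mul_mem_mul hr (Ideal.mem_span_singleton_self _)))
  rw [hmap, IsLocalization.algebraMap_mem_map_algebraMap_iff Q.primeCompl] at this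
  obtain ⟨s, hs, hsx⟩ := this
  exact hs ((hQ s).mpr hsx)

end

/-- Vanishing of `Tor₁(B ⧸ I, M)`, phrased through presentations of `M`. -/
def TorVanishes {B : Type u} [CommRing B] (I : Ideal B) (M : Type u) [AddCommGroup M]
    [Module B M] : Prop :=
  ∀ (L : Type u) [AddCommGroup L] [Module B L] (g : L →ₗ[B] M), Function.Surjective g →
    ∀ x ∈ I • (⊤ : Submodule B L), g x = 0 → x ∈ I • LinearMap.ker g

namespace TorVanishes

section

variable {B : Type u} [CommRing B] {I : Ideal B} {M M' M'' : Type u}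
  [AddCommGroup M] [Module B M] [AddCommGroup M'] [Module B M'] [AddCommGroup M''] [Module B M'']

theorem mem_smul_of_mem_smul (h : TorVanishes I M) {L : Type u} [AddCommGroup L] [Module B L]
    {V K : Submodule B L} (g : V →ₗ[B] M) (hg : Function.Surjective g)
    (hK : ∀ v : V, g v = 0 → (v : L) ∈ K) (x : V) (hx : (x : L) ∈ I • V) (hx0 : g x = 0) :
    (x : L) ∈ I • K := by
  have h1 : x ∈ I • (⊤ : Submodule B V) := by
    have hV : I • V = (I • (⊤ : Submodule B V)).map V.subtype := by
      rw [Submodule.map_smul'', Submodule.map_subtype_top]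
    rw [hV] at hx
    obtain ⟨y, hy, hyx⟩ := hx
    rwa [← Subtype.ext hyx]
  have h2 := Submodule.mem_map_of_mem (f := V.subtype) (h V g hg x h1 hx0)
  rw [Submodule.map_smul''] at h2
  refine Submodule.smul_mono le_rfl ?_ h2
  rintro _ ⟨v, hv, rfl⟩
  exact hK v hv

theorem of_exact (hM' : TorVanishes I M') (hM'' : TorVanishes I M'') (i : M' →ₗ[B] M)
    (p : M →ₗ[B] M'') (hi : Function.Injective i) (hp : Function.Surjective p)
    (hip : Function.Exact i p) : TorVanishes I M := by
  intro L _ _ g hg x hx hx0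
  let V := LinearMap.ker (p ∘ₗ g)
  have hxV : x ∈ I • V := hM'' L (p ∘ₗ g) (hp.comp hg) x hx (by simp [hx0])
  let g' : V →ₗ[B] M' := (LinearEquiv.ofInjective i hi).symm.toLinearMap ∘ₗ
    (g ∘ₗ V.subtype).codRestrict (LinearMap.range i) (fun v ↦ (hip _).mp v.2)
  have hg' (v : V) : i (g' v) = g v := by
    have := LinearEquiv.apply_symm_apply (LinearEquiv.ofInjective i hi)
      ((g ∘ₗ V.subtype).codRestrict (LinearMap.range i) (fun v ↦ (hip _).mp v.2) v)
    exact congr_arg Subtype.val this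
  refine hM'.mem_smul_of_mem_smul g' (fun m ↦ ?_) (fun v hv ↦ ?_)
    ⟨x, by simp [V, hx0]⟩ hxV (hi ?_)
  · obtain ⟨l, hl⟩ := hg (i m)
    refine ⟨⟨l, ?_⟩, hi ?_⟩
    · simpa [V, hl] using (hip _).mpr ⟨m, rfl⟩
    · exact (hg' _).trans hl
  · rw [LinearMap.mem_ker, ← hg', hv, map_zero]
  · rw [hg', hx0, map_zero]

theorem congr (e : M ≃ₗ[B] M') (h : TorVanishes I M) : TorVanishes I M' := by
  intro L _ _ g hg x hx hx0
  have := h L (e.symm.toLinearMap ∘ₗ g) (e.symm.surjective.comp hg) x hx (by simp [hx0])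
  simpa using this

theorem of_subsingleton [Subsingleton M] : TorVanishes I M := by
  intro L _ _ g hg x hx hx0
  rwa [show LinearMap.ker g = ⊤ from by ext; simpa using Subsingleton.elim _ _]

theorem self : TorVanishes I B := by
  intro L _ _ g hg x hx hx0
  obtain ⟨s, hs⟩ := hg 1
  let π : L →ₗ[B] L := LinearMap.id - (LinearMap.toSpanSingleton B L s) ∘ₗ g
  have h1 := Submodule.mem_map_of_mem (f := π) hx
  rw [Submodule.map_smul''] at h1
  have h2 : π x = x := by simp [π, hx0]
  rw [h2] at h1
  refine Submodule.smul_mono le_rfl ?_ h1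
  rintro _ ⟨l, -, rfl⟩
  simp [π, hs]

theorem of_smul_eq_zero {P : B} (hI : I ⊔ Ideal.span {P} = ⊤) (hP : ∀ m : M, P • m = 0) :
    TorVanishes I M := by
  intro L _ _ g hg x hx hx0
  have h1 : (1 : B) ∈ I ⊔ Ideal.span {P} := hI ▸ Submodule.mem_top
  obtain ⟨i, hi, y, hy, h1⟩ := Submodule.mem_sup.mp h1
  obtain ⟨b, rfl⟩ := Ideal.mem_span_singleton'.mp hy
  rw [← one_smul B x, ← h1, add_smul, mul_smul]
  refine add_mem (Submodule.smul_mem_smul hi hx0) (Submodule.smul_mem _ _ ?_)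
  have h2 := Submodule.mem_map_of_mem (f := LinearMap.lsmul B L P) hx
  rw [Submodule.map_smul''] at h2
  refine Submodule.smul_mono le_rfl ?_ h2
  rintro _ ⟨l, -, rfl⟩
  simp [hP]

theorem of_iSup {A : Type u} [CommRing A] [Algebra B A] [Module A M] [IsScalarTower B A M]
    (N : ℕ →o Submodule A M) (hN : ∀ m, ∃ i, m ∈ N i) (h : ∀ i, TorVanishes I (N i)) :
    TorVanishes I M := by
  intro L _ _ g hg x hx hx0
  let V (i : ℕ) : Submodule B L := ((N i).restrictScalars B).comap g
  have hV : Monotone V := fun i j hij ↦ Submodule.comap_mono (N.monotone hij)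
  have htop : ⨆ i, V i = ⊤ := by
    refine eq_top_iff.mpr fun l _ ↦ ?_
    obtain ⟨i, hi⟩ := hN (g l)
    exact Submodule.mem_iSup_of_mem i hi
  rw [← htop, Submodule.smul_iSup, Submodule.mem_iSup_of_directed _
    (Monotone.directed_le fun i j hij ↦ Submodule.smul_mono le_rfl (hV hij))] at hx
  obtain ⟨i, hx⟩ := hx
  let g' : V i →ₗ[B] N i := g.restrict (q := (N i).restrictScalars B) (fun _ h ↦ h)
  refine (h i).mem_smul_of_mem_smul g' (fun m ↦ ?_) (fun v hv ↦ congr_arg Subtype.val hv)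
    ⟨x, by simp [V, hx0]⟩ hx (Subtype.ext hx0)
  obtain ⟨l, hl⟩ := hg m
  exact ⟨⟨l, by simp [V, hl]⟩, Subtype.ext hl⟩

end

/-- Finite `A`-modules have vanishing `Tor₁` over a nonempty basic open subset of `Spec B`. -/
def Generically (B A : Type u) [CommRing B] [CommRing A] [Algebra B A] : Prop :=
  ∀ (M : Type u) [AddCommGroup M] [Module B M] [Module A M] [IsScalarTower B A M]
    [Module.Finite A M], ∃ P : B, P ≠ 0 ∧ ∀ I : Ideal B, I ⊔ Ideal.span {P} = ⊤ → TorVanishes I M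

theorem sup_span_eq_top_of_dvd {B : Type u} [CommRing B] {I : Ideal B} {P Q : B} (h : P ∣ Q)
    (hQ : I ⊔ Ideal.span {Q} = ⊤) : I ⊔ Ideal.span {P} = ⊤ :=
  eq_top_iff.mpr (hQ ▸ sup_le_sup_left (Ideal.span_singleton_le_span_singleton.mpr h) _)

theorem exists_of_finite (B : Type u) [CommRing B] [IsDomain B] [IsNoetherianRing B]
    (M : Type u) [AddCommGroup M] [Module B M] [Module.Finite B M] :
    ∃ P : B, P ≠ 0 ∧ ∀ I : Ideal B, I ⊔ Ideal.span {P} = ⊤ → TorVanishes I M := by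
  induction ‹Module.Finite B M› using
    IsNoetherianRing.induction_on_isQuotientEquivQuotientPrime B with
  | subsingleton N => exact ⟨1, one_ne_zero, fun I _ ↦ of_subsingleton⟩
  | quotient N p e =>
    by_cases hp : p.asIdeal = ⊥
    · refine ⟨1, one_ne_zero, fun I _ ↦ self.congr ?_⟩
      exact (e.trans (Submodule.quotEquivOfEqBot _ hp)).symm
    · obtain ⟨P, hP, hP0⟩ := Submodule.exists_mem_ne_zero_of_ne_bot hp
      refine ⟨P, hP0, fun I hI ↦ (of_smul_eq_zero (P := P) hI ?_).congr e.symm⟩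
      intro m
      obtain ⟨b, rfl⟩ := Ideal.Quotient.mk_surjective m
      rw [← Ideal.Quotient.mk_eq_mk, ← Submodule.Quotient.mk_smul, Submodule.Quotient.mk_eq_zero]
      exact Ideal.mul_mem_right _ _ hP
  | exact N₁ N₂ N₃ i p hi hp hip h₁ h₃ =>
    obtain ⟨P₁, hP₁, h₁⟩ := h₁ 
    obtain ⟨P₃, hP₃, h₃⟩ := h₃ 
    refine ⟨P₁ * P₃, mul_ne_zero hP₁ hP₃, fun I hI ↦ ?_⟩
    exact of_exact (h₁ I (sup_span_eq_top_of_dvd (dvd_mul_right _ _) hI))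
      (h₃ I (sup_span_eq_top_of_dvd (dvd_mul_left _ _) hI)) i p hi hp hip

theorem Generically.of_finite (B A : Type u) [CommRing B] [IsDomain B] [IsNoetherianRing B]
    [CommRing A] [Algebra B A] [Module.Finite B A] : Generically B A := by
  intro M _ _ _ _ _
  have : Module.Finite B M := Module.Finite.trans A M
  exact exists_of_finite B M

theorem Generically.of_surjective {B A C : Type u} [CommRing B] [CommRing A] [CommRing C]
    [Algebra B A] [Algebra B C] (h : Generically B A) (φ : A →ₐ[B] C)
    (hφ : Function.Surjective φ) : Generically B C := by
  intro M _ _ _ _ _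
  let : Module A M := Module.compHom M φ.toRingHom
  have : IsScalarTower B A M := ⟨fun b a m ↦ by
    change φ (b • a) • m = b • φ a • m
    rw [map_smul, smul_assoc]⟩
  let := φ.toRingHom.toAlgebra
  have : IsScalarTower A C M := ⟨fun a c m ↦ by
    change (φ a * c) • m = φ a • c • m
    rw [mul_smul]⟩
  have : Module.Finite A C := Module.Finite.of_surjective (Algebra.linearMap A C) hφ
  have : Module.Finite A M := Module.Finite.trans C M
  exact h M


open Polynomial in
theorem Generically.polynomial {B A : Type u} [CommRing B] [IsDomain B] [CommRing A]
    [IsNoetherianRing A] [Algebra B A] (h : Generically B A) : Generically B A[X] := by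
  intro M _ _ _ _ _
  let : Module A M := Module.compHom M (C : A →+* A[X])
  have : IsScalarTower A A[X] M := ⟨fun a p m ↦ by
    change (a • p) • m = C a • p • m
    rw [smul_eq_C_mul, mul_smul]⟩
  have : IsScalarTower B A M := ⟨fun b a m ↦ by
    change C (b • a) • m = b • C a • m
    rw [← smul_assoc, smul_C]⟩
  obtain ⟨s, hs⟩ := Module.Finite.fg_top (R := A[X]) (M := M)
  let M' : Submodule A M := Submodule.span A (s : Set M)
  have : Module.Finite A M' := Module.Finite.span_of_finite A s.finite_toSet
  let ξ (i : ℕ) : M →ₗ[A] M := Algebra.lsmul A A M ((X : A[X]) ^ i)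
  have hξ (i : ℕ) (m : M) : ξ i m = (X : A[X]) ^ i • m := rfl
  let N (i : ℕ) : Submodule A M := ⨆ k : Fin i, M'.map (ξ k)
  have hsucc (i : ℕ) : N (i + 1) = N i ⊔ M'.map (ξ i) := by
    refine le_antisymm (iSup_le fun k ↦ ?_) (sup_le (iSup_le fun k ↦ ?_) ?_)
    · rcases Nat.lt_succ_iff_lt_or_eq.mp k.2 with hk | hk
      · exact le_sup_of_le_left (le_iSup (fun k : Fin i ↦ M'.map (ξ k)) ⟨k, hk⟩)
      · rw [hk]; exact le_sup_right
    · exact le_iSup (fun k : Fin (i + 1) ↦ M'.map (ξ k)) k.castSucc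
    · exact le_iSup (fun k : Fin (i + 1) ↦ M'.map (ξ k)) (Fin.last i)
  have hle (i : ℕ) : N i ≤ N (i + 1) := hsucc i ▸ le_sup_left
  have hshift (i : ℕ) : (N i).map (ξ 1) ≤ N (i + 1) := by
    rw [Submodule.map_iSup]
    refine iSup_le fun k ↦ ?_
    rw [← Submodule.map_comp]
    refine le_trans (le_of_eq ?_) (le_iSup (fun k : Fin (i + 1) ↦ M'.map (ξ k)) k.succ)
    congr 1
    ext m
    simp only [LinearMap.comp_apply, hξ, smul_smul, ← pow_add, Fin.val_succ, add_comm]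
  let φ (i : ℕ) : M' →ₗ[A] M ⧸ N i := (N i).mkQ ∘ₗ ξ i ∘ₗ M'.subtype
  have hφ (i : ℕ) (m : M') : φ i m = 0 ↔ (X : A[X]) ^ i • (m : M) ∈ N i := by
    simp [φ, hξ]
  let K : ℕ →o Submodule A M' := ⟨fun i ↦ LinearMap.ker (φ i), monotone_nat_of_le_succ
    fun i m hm ↦ by
      rw [LinearMap.mem_ker, hφ] at hm ⊢
      have := hshift i (Submodule.mem_map_of_mem hm)
      rwa [hξ, smul_smul, ← pow_add, add_comm 1 i] at this⟩
  obtain ⟨n, hn⟩ := monotone_stabilizes_iff_noetherian.mpr (inferInstance : IsNoetherian A M') K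
  choose P hP0 hP using fun i ↦ h (M' ⧸ K i)
  refine ⟨∏ i ∈ Finset.range (n + 1), P i, Finset.prod_ne_zero_iff.mpr fun i _ ↦ hP0 i,
    fun I hI ↦ ?_⟩
  have hK (i : ℕ) : TorVanishes I (M' ⧸ K i) := by
    have hK' (i : ℕ) (hi : i ≤ n) : TorVanishes I (M' ⧸ K i) :=
      hP i I (sup_span_eq_top_of_dvd (Finset.dvd_prod_of_mem P (by simpa using by omega)) hI)
    rcases le_total i n with hi | hi
    · exact hK' i hi
    · rw [← hn i hi]
      exact hK' n le_rfl
  have hNT (i : ℕ) : TorVanishes I (N i) := by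
    induction i with
    | zero =>
      have : N 0 = ⊥ := iSup_of_empty _
      rw [this]
      exact of_subsingleton
    | succ i ih =>
      have hmem (m : N (i + 1)) : (N i).mkQ m ∈ LinearMap.range (φ i) := by
        obtain ⟨m, hm⟩ := m
        rw [hsucc] at hm
        obtain ⟨y, hy, _, ⟨z, hz, rfl⟩, rfl⟩ := Submodule.mem_sup.mp hm
        refine ⟨⟨z, hz⟩, ?_⟩
        have : (N i).mkQ y = 0 := by simpa using hy
        simp only [map_add, this, zero_add]
        rfl
      let p : N (i + 1) →ₗ[A] M' ⧸ K i := (φ i).quotKerEquivRange.symm.toLinearMap ∘ₗ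
        ((N i).mkQ ∘ₗ (N (i + 1)).subtype).codRestrict (LinearMap.range (φ i)) hmem
      refine ih.of_exact (hK i) ((Submodule.inclusion (hle i)).restrictScalars B)
        (p.restrictScalars B) (Submodule.inclusion_injective (hle i)) ?_ ?_
      · refine (φ i).quotKerEquivRange.symm.surjective.comp ?_
        rintro ⟨_, ⟨z, rfl⟩⟩
        refine ⟨⟨ξ i z, ?_⟩, rfl⟩
        rw [hsucc]
        exact Submodule.mem_sup_right (Submodule.mem_map_of_mem z.2)
      · intro m
        have h1 : p m = 0 ↔ (m : M) ∈ N i := by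
          have h2 := (φ i).quotKerEquivRange.symm.map_eq_zero_iff
            (x := ⟨(N i).mkQ (m : M), hmem m⟩)
          refine h2.trans ?_
          rw [← Submodule.coe_eq_zero]
          exact Submodule.Quotient.mk_eq_zero _
        refine h1.trans ⟨fun hm ↦ ⟨⟨m, hm⟩, rfl⟩, ?_⟩
        rintro ⟨y, rfl⟩
        exact y.2
  refine of_iSup (A := A) ⟨N, monotone_nat_of_le_succ hle⟩ (fun m ↦ ?_) hNT
  have hm : m ∈ Submodule.span A[X] (s : Set M) := hs ▸ Submodule.mem_top
  have hmono : Monotone N := monotone_nat_of_le_succ hle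
  have hadd (x y : M) (hx : ∃ i, x ∈ N i) (hy : ∃ i, y ∈ N i) : ∃ i, x + y ∈ N i := by
    obtain ⟨i, hx⟩ := hx
    obtain ⟨j, hy⟩ := hy
    exact ⟨max i j, add_mem (hmono (le_max_left i j) hx) (hmono (le_max_right i j) hy)⟩
  have hpow (n i : ℕ) (x : M) (hx : x ∈ N i) : (X : A[X]) ^ n • x ∈ N (i + n) := by
    induction n with
    | zero => simpa using hx
    | succ n ih =>
      have := hshift _ (Submodule.mem_map_of_mem ih)
      rwa [hξ, smul_smul, ← pow_add, add_comm 1 n] at this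
  refine Submodule.span_induction (p := fun m _ ↦ ∃ i, m ∈ N i) (fun m hm ↦ ⟨1, ?_⟩)
    ⟨0, zero_mem _⟩ (fun x y _ _ ↦ hadd x y) (fun p m _ ⟨i, hm⟩ ↦ ?_) hm
  · rw [hsucc]
    exact Submodule.mem_sup_right ⟨m, Submodule.subset_span hm, by simp [hξ]⟩
  · induction p using Polynomial.induction_on' with
    | add p q hp hq => rw [add_smul]; exact hadd _ _ hp hq
    | monomial n a =>
      refine ⟨i + n, ?_⟩
      rw [← C_mul_X_pow_eq_monomial, mul_smul]
      exact (N (i + n)).smul_mem a (hpow n i m hm)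

theorem generically_of_finiteType {B A : Type u} [CommRing B] [IsDomain B] [IsNoetherianRing B]
    [CommRing A] [Algebra B A] [Algebra.FiniteType B A] : Generically B A := by
  have h (n : ℕ) : Generically B (MvPolynomial (Fin n) B) := by
    induction n with
    | zero =>
      have : Module.Finite B (MvPolynomial (Fin 0) B) :=
        Module.Finite.of_surjective (Algebra.linearMap _ _) (MvPolynomial.C_surjective _)
      exact .of_finite _ _
    | succ n ih =>
      exact ih.polynomial.of_surjective
        (MvPolynomial.finSuccEquiv B n).symm.toAlgHom
        (MvPolynomial.finSuccEquiv B n).symm.surjective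
  obtain ⟨n, φ, hφ⟩ := Algebra.FiniteType.iff_quotient_mvPolynomial''.mp ‹Algebra.FiniteType B A›
  exact (h n).of_surjective φ hφ

end TorVanishes

/-- A nonzerodivisor of a finitely generated `B`-algebra stays a nonzerodivisor on the general
fibre. -/
theorem exists_forall_mem_map_of_mul_mem_map {B A : Type u} [CommRing B] [IsDomain B]
    [IsNoetherianRing B] [CommRing A] [Algebra B A] [Algebra.FiniteType B A] {h : A}
    (hh : IsLeftRegular h) : ∃ P : B, P ≠ 0 ∧ ∀ I : Ideal B, I ⊔ Ideal.span {P} = ⊤ →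
      ∀ x, h * x ∈ I.map (algebraMap B A) → x ∈ I.map (algebraMap B A) := by
  obtain ⟨P, hP, hI⟩ := TorVanishes.generically_of_finiteType (B := B) (A := A) (A ⧸ Ideal.span {h})
  refine ⟨P, hP, fun I hIP x hx ↦ ?_⟩
  let g : A →ₗ[B] A ⧸ Ideal.span {h} := (Ideal.Quotient.mkₐ B (Ideal.span {h})).toLinearMap
  have hmem (y : A) : y ∈ I • (⊤ : Submodule B A) ↔ y ∈ I.map (algebraMap B A) := by
    rw [Ideal.smul_top_eq_map]; rfl
  have hker : LinearMap.ker g = (⊤ : Submodule B A).map (LinearMap.mulLeft B h) := by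
    ext y
    have : g y = 0 ↔ y ∈ Ideal.span {h} := Ideal.Quotient.eq_zero_iff_mem
    rw [LinearMap.mem_ker, this, Ideal.mem_span_singleton]
    simp [Dvd.dvd, eq_comm]
  have := hI I hIP A g Ideal.Quotient.mk_surjective (h * x) ((hmem _).mpr hx)
    (Ideal.Quotient.eq_zero_iff_mem.mpr (Ideal.mul_mem_right _ _ (Ideal.mem_span_singleton_self h)))
  rw [hker, ← Submodule.map_smul''] at this
  obtain ⟨y, hy, hyx⟩ := this
  rw [← (hh hyx : y = x)]
  exact (hmem y).mp hy

section

open IsLocalRing RingTheory.Sequence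

/-- A smooth algebra over a field is reduced. -/
theorem isReduced_of_smooth (k : Type*) (T : Type*) [Field k] [CommRing T] [Algebra k T]
    [Algebra.Smooth k T] : IsReduced T := by
  refine isReduced_ofLocalizationMaximal T fun J hJ ↦ ?_
  have := isRegularLocalRing_localization_of_smooth k J
  have := (IsRegularLocalRing.isDomain_and_exists_isWeaklyRegular _
    (Localization.AtPrime J) rfl).1
  infer_instance

/-- Generic smoothness in characteristic zero. -/
theorem exists_smooth_localizationAway {B A : Type u} [CommRing B] [IsDomain B]
    [IsNoetherianRing B] [CharZero B] [CommRing A] [IsDomain A] [Algebra B A]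
    [Algebra.FiniteType B A] (hinj : Function.Injective (algebraMap B A)) :
    ∃ h : A, h ≠ 0 ∧ Algebra.Smooth B (Localization.Away h) := by
  have : Algebra.FinitePresentation B A := Algebra.FinitePresentation.of_finiteType.mp ‹_›
  have : IsNoetherianRing A := Algebra.FiniteType.isNoetherianRing B A
  let K := FractionRing A
  have : FaithfulSMul B A := (faithfulSMul_iff_algebraMap_injective B A).mpr hinj
  have : FaithfulSMul B K := .trans B A K
  let := FractionRing.liftAlgebra B K
  have : IsScalarTower B (FractionRing B) K := FractionRing.isScalarTower_liftAlgebra B K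
  have : CharZero (FractionRing B) := IsFractionRing.charZero B
  have : Algebra.EssFiniteType A K := .of_isLocalization K (nonZeroDivisors A)
  have : Algebra.EssFiniteType B K := .comp B A K
  have : Algebra.EssFiniteType (FractionRing B) K := .of_comp B (FractionRing B) K
  have : Algebra.FormallySmooth B (FractionRing B) := .of_isLocalization (nonZeroDivisors B)
  have : Algebra.FormallySmooth B K := .comp B (FractionRing B) K
  have hprime : (⊥ : Ideal A).primeCompl = nonZeroDivisors A := by
    ext; simp [Ideal.primeCompl]
  have : IsLocalization.AtPrime K (⊥ : Ideal A) := by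
    change IsLocalization _ K
    rw [hprime]; infer_instance
  have : Algebra.IsSmoothAt B (⊥ : Ideal A) := .of_equiv
    ((IsLocalization.algEquiv (⊥ : Ideal A).primeCompl K
      (Localization.AtPrime (⊥ : Ideal A))).restrictScalars B)
  obtain ⟨h, hh, hs⟩ := Algebra.IsSmoothAt.exists_notMem_smooth B (⊥ : Ideal A)
  exact ⟨h, hh, hs⟩

/-- The general fibre of a finitely generated domain is reduced in characteristic zero. -/
theorem exists_forall_isRadical_map {B A : Type u} [CommRing B] [IsDomain B]
    [IsNoetherianRing B] [CharZero B] [CommRing A] [IsDomain A] [Algebra B A]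
    [Algebra.FiniteType B A] : ∃ P : B, P ≠ 0 ∧ ∀ I : Ideal B, I.IsMaximal →
      I ⊔ Ideal.span {P} = ⊤ → (I.map (algebraMap B A)).IsRadical := by
  by_cases hinj : Function.Injective (algebraMap B A)
  · obtain ⟨h, hh, hs⟩ := exists_smooth_localizationAway hinj
    obtain ⟨P, hP, hI⟩ := exists_forall_mem_map_of_mul_mem_map (B := B)
      (IsRegular.of_ne_zero hh).left
    refine ⟨P, hP, fun I hImax hIP x hx ↦ ?_⟩
    let := Ideal.Quotient.field I
    let S := Localization.Away h
    have : Algebra.Smooth (B ⧸ I) (S ⧸ I.map (algebraMap B S)) :=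
      .of_equiv (Algebra.TensorProduct.quotIdealMapEquivQuotTensor S I).symm
    have hred := isReduced_of_smooth (B ⧸ I) (S ⧸ I.map (algebraMap B S))
    have hmap : I.map (algebraMap B S) = (I.map (algebraMap B A)).map (algebraMap A S) := by
      rw [Ideal.map_map, ← IsScalarTower.algebraMap_eq]
    have hxS : algebraMap A S x ∈ (I.map (algebraMap B A)).map (algebraMap A S) := by
      rw [← hmap]
      refine (Ideal.isRadical_iff_quotient_reduced _).mpr hred ?_
      rw [hmap]
      obtain ⟨n, hn⟩ := hx
      exact ⟨n, by rw [← map_pow]; exact Ideal.mem_map_of_mem _ hn⟩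
    rw [IsLocalization.algebraMap_mem_map_algebraMap_iff (Submonoid.powers h)] at hxS
    obtain ⟨_, ⟨n, rfl⟩, hn⟩ := hxS
    induction n with
    | zero => simpa using hn
    | succ n ih =>
      refine ih (hI I hIP _ ?_)
      rwa [← mul_assoc, ← pow_succ']
  · rw [injective_iff_map_eq_zero] at hinj
    push Not at hinj
    obtain ⟨P, hP, hP0⟩ := hinj
    refine ⟨P, hP0, fun I _ hI ↦ ?_⟩
    have : I.map (algebraMap B A) = ⊤ := by
      have := congr_arg (Ideal.map (algebraMap B A)) hI
      rwa [Ideal.map_sup, Ideal.map_span, Set.image_singleton, hP, Ideal.span_singleton_zero,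
        sup_bot_eq, Ideal.map_top] at this
    rw [this]
    exact fun _ _ ↦ trivial

end

section

open MvPolynomial

theorem ker_eval_isMaximal {σ k : Type*} [Field k] (a : σ → k) :
    (RingHom.ker (eval a)).IsMaximal :=
  RingHom.ker_isMaximal_of_surjective _ fun x ↦ ⟨C x, by simp⟩

theorem ker_eval_sup_span_eq_top {σ k : Type*} [Field k] {a : σ → k} {P : MvPolynomial σ k}
    (hP : eval a P ≠ 0) : RingHom.ker (eval a) ⊔ Ideal.span {P} = ⊤ := by
  refine (ker_eval_isMaximal a).1.2 _ (lt_of_le_of_ne le_sup_left fun h ↦ hP ?_)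
  rw [← RingHom.mem_ker, h]
  exact Ideal.mem_sup_right (Ideal.mem_span_singleton_self P)

theorem exists_eval_ne_zero_imp_mem_map_ker {σ A : Type} [Finite σ] [CommRing A]
    [IsDomain A] [Algebra ℂ A] [Algebra.FiniteType ℂ A] (φ : MvPolynomial σ ℂ →ₐ[ℂ] A) {h : A}
    (hh : h ≠ 0) : ∃ P : MvPolynomial σ ℂ, P ≠ 0 ∧ ∀ a : σ → ℂ, eval a P ≠ 0 →
      ∀ x, h * x ∈ (RingHom.ker (eval a)).map φ.toRingHom →
        x ∈ (RingHom.ker (eval a)).map φ.toRingHom := by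
  let := φ.toRingHom.toAlgebra
  have : IsScalarTower ℂ (MvPolynomial σ ℂ) A := .of_algebraMap_eq fun x ↦ (φ.commutes x).symm
  have : Algebra.FiniteType (MvPolynomial σ ℂ) A := .of_restrictScalars_finiteType ℂ _ _
  obtain ⟨P, hP, H⟩ := exists_forall_mem_map_of_mul_mem_map (B := MvPolynomial σ ℂ)
    (IsRegular.of_ne_zero hh).left
  exact ⟨P, hP, fun a ha ↦ H _ (ker_eval_sup_span_eq_top ha)⟩

theorem exists_eval_ne_zero_imp_isRadical_map_ker {σ A : Type} [Finite σ] [CommRing A]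
    [IsDomain A] [Algebra ℂ A] [Algebra.FiniteType ℂ A] (φ : MvPolynomial σ ℂ →ₐ[ℂ] A) :
    ∃ P : MvPolynomial σ ℂ, P ≠ 0 ∧ ∀ a : σ → ℂ, eval a P ≠ 0 →
      ((RingHom.ker (eval a)).map φ.toRingHom).IsRadical := by
  let := φ.toRingHom.toAlgebra
  have : IsScalarTower ℂ (MvPolynomial σ ℂ) A := .of_algebraMap_eq fun x ↦ (φ.commutes x).symm
  have : Algebra.FiniteType (MvPolynomial σ ℂ) A := .of_restrictScalars_finiteType ℂ _ _
  have : CharZero (MvPolynomial σ ℂ) := charZero_of_injective_algebraMap (C_injective σ ℂ)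
  obtain ⟨P, hP, H⟩ := exists_forall_isRadical_map (B := MvPolynomial σ ℂ) (A := A)
  exact ⟨P, hP, fun a ha ↦ H _ (ker_eval_isMaximal a) (ker_eval_sup_span_eq_top ha)⟩

/-- The linear combination of `f` with the scalar coefficients in row `i` of `a`. -/
noncomputable def rowCombination {ι κ L : Type*} [Fintype κ] [CommRing L] [Algebra ℂ L]
    (f : κ → L) (a : ι × κ → ℂ) (i : ι) : L :=
  ∑ k, a (i, k) • f k

section

variable {ι κ L : Type} [Fintype κ] [CommRing L] [Algebra ℂ L] (f : κ → L)

open Classical in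
/-- The universal solution of the equations `∑ k, y (i, k) * f k = 0` for `i ∈ s`, where `u` is an
inverse of `f j`. -/
noncomputable def solveRows (s : Set ι) (j : κ) (u : L) :
    MvPolynomial (ι × κ) ℂ →ₐ[ℂ] MvPolynomial (ι × κ) L :=
  aeval fun ik ↦ if ik.1 ∈ s ∧ ik.2 = j then
    X ik - C u * ∑ k, X (ik.1, k) * C (f k) else X ik

variable {f} {s : Set ι} {j : κ} {u : L}

theorem X_sub_C_mem_map_solveRows (a : ι × κ → ℂ) (ik : ι × κ) :
    solveRows f s j u (X ik) - C (algebraMap ℂ L (a ik)) ∈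
      (RingHom.ker (eval a)).map (solveRows f s j u).toRingHom := by
  have h : (X ik - C (a ik) : MvPolynomial (ι × κ) ℂ) ∈ RingHom.ker (eval a) := by
    simp [RingHom.mem_ker]
  have := Ideal.mem_map_of_mem (solveRows f s j u).toRingHom h
  rw [map_sub] at this
  convert! this using 2
  exact ((solveRows f s j u).commutes (a ik)).symm

theorem C_rowCombination_sub_mem_map_solveRows (a : ι × κ → ℂ) (i : ι) :
    C (rowCombination f a i) - ∑ k, solveRows f s j u (X (i, k)) * C (f k) ∈
      (RingHom.ker (eval a)).map (solveRows f s j u).toRingHom := by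
  rw [rowCombination, map_sum, ← Finset.sum_sub_distrib]
  refine Ideal.sum_mem _ fun k _ ↦ ?_
  rw [Algebra.smul_def, map_mul, ← sub_mul]
  refine Ideal.mul_mem_right _ _ ?_
  rw [← neg_mem_iff, neg_sub]
  exact X_sub_C_mem_map_solveRows a (i, k)

theorem sum_solveRows_eq_zero (hu : u * f j = 1) {i : ι} (hi : i ∈ s) :
    ∑ k, solveRows f s j u (X (i, k)) * C (f k) = 0 := by
  classical
  have h (k : κ) : solveRows f s j u (X (i, k)) * C (f k) = X (i, k) * C (f k) -
      if k = j then (∑ k, X (i, k) * C (f k)) else 0 := by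
    by_cases hk : k = j
    · subst hk
      simp only [solveRows, aeval_X, hi, and_self, if_true, sub_mul]
      rw [mul_right_comm, ← C_mul, hu, C_1, one_mul]
    · simp [solveRows, hk]
  simp [h, Finset.sum_sub_distrib]

theorem C_mem_map_solveRows_iff (hu : u * f j = 1) (a : ι × κ → ℂ) (x : L) :
    C x ∈ (RingHom.ker (eval a)).map (solveRows f s j u).toRingHom ↔
      x ∈ Ideal.span (rowCombination f a '' s) := by
  classical
  constructor
  · intro hx
    let ev : MvPolynomial (ι × κ) L →+* L := eval fun ik ↦ algebraMap ℂ L (a ik)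
    let q := Ideal.Quotient.mk (Ideal.span (rowCombination f a '' s))
    have hcomp : (q.comp ev).comp (solveRows f s j u).toRingHom =
        (q.comp (algebraMap ℂ L)).comp (eval a) := by
      refine MvPolynomial.ringHom_ext (fun r ↦ ?_) fun ik ↦ ?_
      · simp only [RingHom.comp_apply, eval_C]
        congr 1
        have : solveRows f s j u (C r) = C (algebraMap ℂ L r) := (solveRows f s j u).commutes r
        exact (congr_arg ev this).trans (eval_C _)
      · simp only [RingHom.comp_apply, eval_X]
        refine Ideal.Quotient.eq.mpr ?_
        change ev (solveRows f s j u (X ik)) - _ ∈ _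
        simp only [solveRows, aeval_X]
        split_ifs with h
        · simp only [ev, map_sub, eval_X, map_mul, eval_C, map_sum]
          rw [sub_right_comm, sub_self, zero_sub, neg_mem_iff]
          refine Ideal.mul_mem_left _ _ (Ideal.subset_span ⟨ik.1, h.1, ?_⟩)
          simp [rowCombination, Algebra.smul_def]
        · simp [ev]
    have h1 := Ideal.mem_map_of_mem (q.comp ev) hx
    rw [Ideal.map_map, hcomp, ← Ideal.map_map] at h1
    have h2 : (RingHom.ker (eval a)).map (eval a) = ⊥ := by
      rw [Ideal.map_eq_bot_iff_le_ker]
    rw [h2, Ideal.map_bot, Ideal.mem_bot] at h1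
    simpa [ev, q, Ideal.Quotient.eq_zero_iff_mem] using h1
  · intro hx
    rw [← Ideal.mem_comap]
    refine (Ideal.span_le.mpr ?_ : Ideal.span _ ≤ _) hx
    rintro _ ⟨i, hi, rfl⟩
    have := C_rowCombination_sub_mem_map_solveRows (f := f) (s := s) (j := j) (u := u) a i
    rwa [sum_solveRows_eq_zero hu hi, sub_zero] at this

variable [Finite ι] [IsDomain L] [Algebra.FiniteType ℂ L]

theorem exists_forall_isRadical_span_rowCombination (f : κ → L) (s : Set ι) {j : κ}
    (hj : IsUnit (f j)) : ∃ P : MvPolynomial (ι × κ) ℂ, P ≠ 0 ∧ ∀ a, eval a P ≠ 0 →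
      (Ideal.span (rowCombination f a '' s)).IsRadical := by
  obtain ⟨u, hu⟩ := hj.exists_left_inv
  have : Algebra.FiniteType ℂ (MvPolynomial (ι × κ) L) := .trans (S := L) ‹_› inferInstance
  obtain ⟨P, hP, H⟩ := exists_eval_ne_zero_imp_isRadical_map_ker (solveRows f s j u)
  refine ⟨P, hP, fun a ha x ⟨n, hn⟩ ↦ ?_⟩
  rw [← C_mem_map_solveRows_iff hu] at hn ⊢
  exact H a ha ⟨n, by rwa [← map_pow]⟩

theorem exists_forall_mem_span_rowCombination (f : κ → L) (s : Set ι) {j : κ}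
    (hj : IsUnit (f j)) {i : ι} (hi : i ∉ s) :
    ∃ P : MvPolynomial (ι × κ) ℂ, P ≠ 0 ∧ ∀ a, eval a P ≠ 0 → ∀ x,
      rowCombination f a i * x ∈ Ideal.span (rowCombination f a '' s) →
        x ∈ Ideal.span (rowCombination f a '' s) := by
  classical
  obtain ⟨u, hu⟩ := hj.exists_left_inv
  have : Algebra.FiniteType ℂ (MvPolynomial (ι × κ) L) := .trans (S := L) ‹_› inferInstance
  have hE : ∑ k, solveRows f s j u (X (i, k)) * C (f k) ≠ 0 := by
    intro h
    have := congr_arg (eval (Function.update 0 (i, j) 1)) h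
    simp [solveRows, hi, Function.update_apply, hj.ne_zero] at this
  obtain ⟨P, hP, H⟩ := exists_eval_ne_zero_imp_mem_map_ker (solveRows f s j u) hE
  refine ⟨P, hP, fun a ha x hx ↦ ?_⟩
  rw [← C_mem_map_solveRows_iff hu] at hx ⊢
  refine H a ha _ ?_
  have := Ideal.mul_mem_right (C x) _
    (C_rowCombination_sub_mem_map_solveRows (f := f) (s := s) (j := j) (u := u) a i)
  rw [sub_mul, ← C_mul] at this
  simpa using sub_mem hx this

end

section

variable {ι κ R : Type} [Fintype κ] [CommRing R] [Algebra ℂ R]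

theorem algebraMap_rowCombination {L : Type} [CommRing L] [Algebra ℂ L] [Algebra R L]
    [IsScalarTower ℂ R L] (f : κ → R) (a : ι × κ → ℂ) (i : ι) :
    rowCombination (fun k ↦ algebraMap R L (f k)) a i = algebraMap R L (rowCombination f a i) := by
  simp only [rowCombination, map_sum]
  exact Finset.sum_congr rfl fun k _ ↦ (map_smul (IsScalarTower.toAlgHom ℂ R L) _ _).symm

theorem algebraMap_mem_span_rowCombination_away_iff (f : κ → R) (a : ι × κ → ℂ) (s : Set ι) (j : κ)
    (x : R) :
    algebraMap R (Localization.Away (f j)) x ∈ Ideal.span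
        (rowCombination (fun k ↦ algebraMap R (Localization.Away (f j)) (f k)) a '' s) ↔
      ∃ n : ℕ, f j ^ n * x ∈ Ideal.span (rowCombination f a '' s) := by
  have : Ideal.span (rowCombination (fun k ↦ algebraMap R (Localization.Away (f j)) (f k)) a '' s) =
      (Ideal.span (rowCombination f a '' s)).map (algebraMap R (Localization.Away (f j))) := by
    rw [Ideal.map_span, ← Set.image_comp]
    congr 1
    exact Set.image_congr fun i _ ↦ algebraMap_rowCombination f a i
  rw [this, IsLocalization.algebraMap_mem_map_algebraMap_iff (Submonoid.powers (f j))]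
  constructor
  · rintro ⟨_, ⟨n, rfl⟩, h⟩
    exact ⟨n, h⟩
  · rintro ⟨n, h⟩
    exact ⟨_, ⟨n, rfl⟩, h⟩

variable [Finite ι] [IsDomain R] [Algebra.FiniteType ℂ R]

/-- General scalar combinations of `f` generate an ideal that is radical where `f j ≠ 0`. -/
theorem exists_forall_pow_mul_mem_of_mem_radical (f : κ → R) (s : Set ι) (j : κ) :
    ∃ P : MvPolynomial (ι × κ) ℂ, P ≠ 0 ∧ ∀ a, eval a P ≠ 0 →
      ∀ x ∈ (Ideal.span (rowCombination f a '' s)).radical,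
        ∃ n : ℕ, f j ^ n * x ∈ Ideal.span (rowCombination f a '' s) := by
  by_cases hj : f j = 0
  · exact ⟨1, one_ne_zero, fun a _ x _ ↦ ⟨1, by simp [hj]⟩⟩
  have : IsDomain (Localization.Away (f j)) := IsLocalization.isDomain_localization
    (powers_le_nonZeroDivisors_of_noZeroDivisors hj)
  have : Algebra.FiniteType R (Localization.Away (f j)) :=
    IsLocalization.finiteType_of_monoid_fg (Submonoid.powers (f j)) _
  have : Algebra.FiniteType ℂ (Localization.Away (f j)) := .trans ‹_› this
  obtain ⟨P, hP, h⟩ := exists_forall_isRadical_span_rowCombination (ι := ι)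
    (fun k ↦ algebraMap R (Localization.Away (f j)) (f k)) s (j := j)
    (IsLocalization.Away.algebraMap_isUnit _)
  refine ⟨P, hP, fun a ha x ⟨n, hx⟩ ↦ ?_⟩
  rw [← algebraMap_mem_span_rowCombination_away_iff]
  refine h a ha ⟨n, ?_⟩
  rw [← map_pow, algebraMap_mem_span_rowCombination_away_iff]
  exact ⟨0, by simpa using hx⟩

/-- General scalar combinations of `f` form a regular sequence where `f j ≠ 0`. -/
theorem exists_forall_pow_mul_mem_of_mul_mem (f : κ → R) (s : Set ι) (j : κ) {i : ι}
    (hi : i ∉ s) :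
    ∃ P : MvPolynomial (ι × κ) ℂ, P ≠ 0 ∧ ∀ a, eval a P ≠ 0 →
      ∀ x, rowCombination f a i * x ∈ Ideal.span (rowCombination f a '' s) →
        ∃ n : ℕ, f j ^ n * x ∈ Ideal.span (rowCombination f a '' s) := by
  by_cases hj : f j = 0
  · exact ⟨1, one_ne_zero, fun a _ x _ ↦ ⟨1, by simp [hj]⟩⟩
  have : IsDomain (Localization.Away (f j)) := IsLocalization.isDomain_localization
    (powers_le_nonZeroDivisors_of_noZeroDivisors hj)
  have : Algebra.FiniteType R (Localization.Away (f j)) :=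
    IsLocalization.finiteType_of_monoid_fg (Submonoid.powers (f j)) _
  have : Algebra.FiniteType ℂ (Localization.Away (f j)) := .trans ‹_› this
  obtain ⟨P, hP, h⟩ := exists_forall_mem_span_rowCombination (ι := ι)
    (fun k ↦ algebraMap R (Localization.Away (f j)) (f k)) s (j := j)
    (IsLocalization.Away.algebraMap_isUnit _) hi
  refine ⟨P, hP, fun a ha x hx ↦ ?_⟩
  rw [← algebraMap_mem_span_rowCombination_away_iff]
  refine h a ha _ ?_
  rw [algebraMap_rowCombination, ← map_mul, algebraMap_mem_span_rowCombination_away_iff]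
  exact ⟨0, by simpa using hx⟩

end

/-- A nonzero polynomial over an algebra `K` over a field `k` is nonzero at general
`k`-rational points. -/
theorem exists_forall_eval_algebraMap_ne_zero {σ k K : Type*} [Field k] [CommRing K] [Algebra k K]
    {D : MvPolynomial σ K} (hD : D ≠ 0) : ∃ P : MvPolynomial σ k, P ≠ 0 ∧
      ∀ a : σ → k, eval a P ≠ 0 → eval (fun i ↦ algebraMap k K (a i)) D ≠ 0 := by
  obtain ⟨m, hm⟩ := MvPolynomial.ne_zero_iff.mp hD
  obtain ⟨l, hl⟩ : ∃ l : Module.Dual k K, l (D.coeff m) ≠ 0 := by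
    by_contra! h
    exact hm ((Module.forall_dual_apply_eq_zero_iff k _).mp h)
  refine ⟨∑ n ∈ D.support, monomial n (l (D.coeff n)), fun h ↦ hl ?_, fun a ha h ↦ ha ?_⟩
  · have := congrArg (coeff m) h
    classical
    simpa [coeff_sum, coeff_monomial, hm] using this
  · have := congrArg l h
    rw [eval_eq, map_sum, map_zero] at this
    rw [map_sum, ← this]
    refine Finset.sum_congr rfl fun n _ ↦ ?_
    have : D.coeff n * ∏ i ∈ n.support, algebraMap k K (a i) ^ n i =
        (∏ i ∈ n.support, a i ^ n i) • D.coeff n := by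
      rw [Algebra.smul_def, map_prod, mul_comm]
      simp
    rw [this, map_smul, eval_monomial, smul_eq_mul, mul_comm]
    rfl

/-- General `k`-linear combinations of a spanning family span. -/
theorem exists_forall_span_range_sum_smul_eq_top {κ k K V : Type*} [Fintype κ] [Field k] [Field K]
    [Algebra k K] [AddCommGroup V] [Module K V] [Module.Finite K V] {c : ℕ}
    (hc : Module.finrank K V = c) (v : κ → V) (hv : Submodule.span K (Set.range v) = ⊤) :
    ∃ P : MvPolynomial (Fin c × κ) k, P ≠ 0 ∧ ∀ a, eval a P ≠ 0 →
      Submodule.span K (Set.range fun i ↦ ∑ j, algebraMap k K (a (i, j)) • v j) = ⊤ := by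
  let b := Module.finBasisOfFinrankEq K V hc
  let D : MvPolynomial (Fin c × κ) K :=
    (Matrix.of fun i l ↦ ∑ j, X (i, j) * C (b.repr (v j) l)).det
  have hDe (a : Fin c × κ → K) : eval a D = b.det fun i ↦ ∑ j, a (i, j) • v j := by
    rw [Module.Basis.det_apply, ← Matrix.det_transpose, RingHom.map_det]
    congr 1
    ext i l
    simp [Module.Basis.toMatrix_apply]
  have hb : ∀ l, ∃ a : κ → K, ∑ j, a j • v j = b l := fun l ↦ by
    rw [← Submodule.mem_span_range_iff_exists_fun, hv]
    trivial
  choose a₀ ha₀ using hb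
  have hD : D ≠ 0 := fun h ↦ by
    have := hDe fun ij ↦ a₀ ij.1 ij.2
    simp only [ha₀, h, map_zero] at this
    exact zero_ne_one (this.trans b.det_self)
  obtain ⟨P, hP, h⟩ := exists_forall_eval_algebraMap_ne_zero (k := k) hD
  refine ⟨P, hP, fun a ha ↦ ?_⟩
  have := h a ha
  rw [hDe] at this
  exact ((Module.Basis.is_basis_iff_det b).mpr this.isUnit).2

open IsLocalRing in
theorem span_range_toCotangent_eq_top_iff {ι S : Type*} [CommRing S] [IsLocalRing S]
    [IsNoetherianRing S] (g : ι → maximalIdeal S) : Submodule.span (ResidueField S)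
      (Set.range fun i ↦ (maximalIdeal S).toCotangent (g i)) = ⊤ ↔
      Ideal.span (Set.range fun i ↦ (g i : S)) = maximalIdeal S := by
  have h : (Set.range fun i ↦ (maximalIdeal S).toCotangent (g i)) =
      (maximalIdeal S).toCotangent '' Set.range g := Set.range_comp _ g
  rw [h, CotangentSpace.span_image_eq_top_iff,
    ← (Submodule.map_injective_of_injective (maximalIdeal S).injective_subtype).eq_iff,
    Submodule.map_span, Submodule.map_top, Submodule.range_subtype, ← Set.range_comp]
  rfl

open IsLocalRing in
/-- General linear combinations of generators of the maximal ideal of a regular local ring, as many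
as the dimension, again generate the maximal ideal. -/
theorem exists_forall_span_range_sum_smul_eq_maximalIdeal {κ S : Type*} [Fintype κ]
    [CommRing S] [IsRegularLocalRing S] {k : Type*} [Field k] [Algebra k S] {c : ℕ}
    (hc : ringKrullDim S = c) (f : κ → S) (hf : Ideal.span (Set.range f) = maximalIdeal S) :
    ∃ P : MvPolynomial (Fin c × κ) k, P ≠ 0 ∧ ∀ a, eval a P ≠ 0 →
      Ideal.span (Set.range fun i ↦ ∑ j, a (i, j) • f j) = maximalIdeal S := by
  have hfin : Module.finrank (ResidueField S) (CotangentSpace S) = c := by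
    have := (IsRegularLocalRing.iff_finrank_cotangentSpace S).mp inferInstance
    rw [hc] at this
    exact_mod_cast this
  have hmem (j) : f j ∈ maximalIdeal S := hf ▸ Ideal.subset_span ⟨j, rfl⟩
  obtain ⟨P, hP, h⟩ := exists_forall_span_range_sum_smul_eq_top (k := k) hfin
    (fun j ↦ (maximalIdeal S).toCotangent ⟨f j, hmem j⟩) 
    ((span_range_toCotangent_eq_top_iff fun j ↦ ⟨f j, hmem j⟩).mpr hf)
  refine ⟨P, hP, fun a ha ↦ ?_⟩
  have := h a ha
  have h2 : (fun i ↦ ∑ j, algebraMap k (ResidueField S) (a (i, j)) •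
      (maximalIdeal S).toCotangent ⟨f j, hmem j⟩) = fun i ↦ (maximalIdeal S).toCotangent
        (∑ j, algebraMap k S (a (i, j)) • ⟨f j, hmem j⟩) := by
    ext i
    rw [map_sum]
    refine Finset.sum_congr rfl fun j _ ↦ ?_
    rw [map_smul, IsScalarTower.algebraMap_apply k S (ResidueField S), algebraMap_smul]
  rw [h2, span_range_toCotangent_eq_top_iff] at this
  rw [← this]
  simp [Algebra.smul_def]

/-- As many general linear combinations of generators of a radical ideal as the height of a minimal
prime `p` generate that ideal locally at `p`. -/
theorem exists_forall_mul_mem_span_range_sum_smul {κ R : Type*} [Fintype κ] [CommRing R]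
    [IsNoetherianRing R] {k : Type*} [Field k] [Algebra k R] (p : Ideal R) [p.IsPrime]
    [IsRegularLocalRing (Localization.AtPrime p)] {c : ℕ} (hc : p.height = c) (f : κ → R)
    (hrad : (Ideal.span (Set.range f)).IsRadical)
    (hp : p ∈ (Ideal.span (Set.range f)).minimalPrimes) :
    ∃ P : MvPolynomial (Fin c × κ) k, P ≠ 0 ∧ ∀ a, eval a P ≠ 0 →
      ∀ x ∈ p, ∃ s ∉ p, s * x ∈ Ideal.span (Set.range fun i ↦ ∑ j, a (i, j) • f j) := by
  let S := Localization.AtPrime p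
  have hdim : ringKrullDim S = c := by
    rw [IsLocalization.AtPrime.ringKrullDim_eq_height p, hc]
    rfl
  have hf : Ideal.span (Set.range fun j ↦ algebraMap R S (f j)) = IsLocalRing.maximalIdeal S := by
    have h₁ : (Set.range fun j ↦ algebraMap R S (f j)) = algebraMap R S '' Set.range f :=
      Set.range_comp _ f
    rw [h₁, ← Ideal.map_span, ← IsLocalization.AtPrime.map_eq_maximalIdeal p S,
      ← IsLocalization.AtPrime.radical_map_of_mem_minimalPrimes S p _ hp,
      ← IsLocalization.map_radical p.primeCompl, hrad.radical]
  obtain ⟨P, hP, h⟩ := exists_forall_span_range_sum_smul_eq_maximalIdeal (k := k) hdim _ hf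
  refine ⟨P, hP, fun a ha x hx ↦ ?_⟩
  have h₂ : (Set.range fun i ↦ ∑ j, a (i, j) • algebraMap R S (f j)) =
      algebraMap R S '' Set.range fun i ↦ ∑ j, a (i, j) • f j := by
    rw [← Set.range_comp]
    congr 1
    ext i
    simp [Algebra.smul_def, IsScalarTower.algebraMap_apply k R S]
  have := h a ha
  rw [h₂, ← Ideal.map_span] at this
  obtain ⟨s, hs, hsx⟩ := (IsLocalization.algebraMap_mem_map_algebraMap_iff p.primeCompl S _ x).mp
    (this ▸ (IsLocalization.AtPrime.to_map_mem_maximal_iff S p x).mpr hx)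
  exact ⟨s, hs, hsx⟩

/-- Finitely many generic conditions can be imposed simultaneously. -/
theorem exists_forall_of_finite {σ ι k : Type*} [Finite ι] [Field k] {C : ι → (σ → k) → Prop}
    (h : ∀ i, ∃ P : MvPolynomial σ k, P ≠ 0 ∧ ∀ a, eval a P ≠ 0 → C i a) :
    ∃ P : MvPolynomial σ k, P ≠ 0 ∧ ∀ a, eval a P ≠ 0 → ∀ i, C i a := by
  have := Fintype.ofFinite ι
  choose P hP hC using h
  refine ⟨∏ i, P i, Finset.prod_ne_zero_iff.mpr fun i _ ↦ hP i, fun a ha i ↦ hC i a ?_⟩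
  rw [map_prod] at ha
  exact Finset.prod_ne_zero_iff.mp ha i (Finset.mem_univ i)

end

section

open RingTheory.Sequence

theorem Ideal.ofList_take_ofFn {R : Type*} [CommRing R] {c : ℕ} (α : Fin c → R) (n : ℕ) :
    Ideal.ofList ((List.ofFn α).take n) = Ideal.span (α '' {i | i.val < n}) := by
  rw [Ideal.ofList]
  congr 1
  ext x
  simp only [Set.mem_ofPred_eq, List.mem_take_iff_getElem, Set.mem_image]
  constructor
  · rintro ⟨i, hi, rfl⟩
    simp only [List.length_ofFn, lt_inf_iff] at hi
    exact ⟨⟨i, hi.2⟩, hi.1, by simp⟩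
  · rintro ⟨i, hi, rfl⟩
    exact ⟨i, by simpa using hi, by simp⟩

theorem Ideal.ofList_ofFn {R : Type*} [CommRing R] {c : ℕ} (α : Fin c → R) :
    Ideal.ofList (List.ofFn α) = Ideal.span (Set.range α) := by
  rw [Ideal.ofList]
  congr 1
  ext x
  simp [List.mem_ofFn]

section

variable {R : Type u} [CommRing R] [IsNoetherianRing R]

theorem exists_forall_mem_iff_of_mem_minimalPrimes {J Q : Ideal R} (hQ : Q ∈ J.minimalPrimes) :
    ∃ x, ∀ r, r ∈ Q ↔ r * x ∈ J := by
  have hJ : J = Submodule.colon J {(1 : R)} := by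
    ext r
    simp [Submodule.mem_colon_singleton]
  obtain ⟨x, rfl⟩ := Submodule.exists_eq_colon_of_mem_minimalPrimes (N := J) (hJ ▸ hQ)
  exact ⟨x, fun r ↦ by simp [Submodule.mem_colon_singleton]⟩

theorem mem_associatedPrimes_quotient_iff {J Q : Ideal R} :
    Q ∈ associatedPrimes R (R ⧸ J) ↔ Q.IsPrime ∧ ∃ x, ∀ r, r ∈ Q ↔ r * x ∈ J := by
  rw [AssociatedPrimes.mem_iff, isAssociatedPrime_iff, Ideal.Quotient.mk_surjective.exists]
  refine and_congr_right fun _ ↦ exists_congr fun x ↦ SetLike.ext_iff.trans ?_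
  refine forall_congr' fun r ↦ iff_congr Iff.rfl ?_
  rw [Submodule.mem_colon_singleton, Submodule.mem_bot, Algebra.smul_def,
    Ideal.Quotient.algebraMap_eq, ← map_mul, Ideal.Quotient.eq_zero_iff_mem]

theorem exists_isPrime_forall_mem_iff_of_notMem {J : Ideal R} {x : R} (hx : x ∉ J) :
    ∃ Q : Ideal R, Q.IsPrime ∧ (∃ y, ∀ r, r ∈ Q ↔ r * y ∈ J) ∧ ∀ r, r * x ∈ J → r ∈ Q := by
  obtain ⟨Q, hQ, hxQ⟩ := exists_le_isAssociatedPrime_of_isNoetherianRing (R := R)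
    (Ideal.Quotient.mk J x) (mt Ideal.Quotient.eq_zero_iff_mem.mp hx)
  obtain ⟨hQp, y, hy⟩ := mem_associatedPrimes_quotient_iff.mp hQ
  refine ⟨Q, hQp, ⟨y, hy⟩, fun r hr ↦ hxQ ?_⟩
  rwa [Submodule.mem_colon_singleton, Submodule.mem_bot, Algebra.smul_def,
    Ideal.Quotient.algebraMap_eq, ← map_mul, Ideal.Quotient.eq_zero_iff_mem]

variable {c : ℕ} {κ : Type*} {f : κ → R} {α : Fin c → R}

theorem le_height_of_notMem
    (hreg : ∀ i j x, α i * x ∈ Ideal.span (α '' {i' | i'.val < i.val}) →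
      ∃ n : ℕ, f j ^ n * x ∈ Ideal.span (α '' {i' | i'.val < i.val}))
    {n : ℕ} (hn : n ≤ c) {Q : Ideal R} [Q.IsPrime] (hQ : Ideal.span (α '' {i | i.val < n}) ≤ Q)
    {j : κ} (hj : f j ∉ Q) : n ≤ Q.height := by
  induction n generalizing Q with
  | zero => simp
  | succ n ih =>
    have hle : Ideal.span (α '' {i | i.val < n}) ≤ Q :=
      le_trans (Ideal.span_mono
        (Set.image_mono fun i (hi : i.val < n) ↦ hi.trans n.lt_succ_self)) hQ
    obtain ⟨Q', hQ', hQQ'⟩ := Ideal.exists_minimalPrimes_le hle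
    have := hQ'.1.1
    have hj' : f j ∉ Q' := fun h ↦ hj (hQQ' h)
    obtain ⟨x, hx⟩ := exists_forall_mem_iff_of_mem_minimalPrimes hQ'
    have hα : α ⟨n, hn⟩ ∉ Q' := fun h ↦ by
      obtain ⟨m, hm⟩ := hreg ⟨n, hn⟩ j x ((hx _).mp h)
      exact hj' (this.mem_of_pow_mem m ((hx _).mpr hm))
    have hlt : Q' < Q := lt_of_le_of_ne hQQ' fun h ↦ hα
      (h ▸ hQ (Ideal.subset_span ⟨⟨n, hn⟩, n.lt_succ_self, rfl⟩))
    calc ((n + 1 : ℕ) : ℕ∞) = n + 1 := by simp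
      _ ≤ Q'.height + 1 := by gcongr; exact ih (n.le_succ.trans hn) hQ'.1.2 hj'
      _ ≤ Q.height := Ideal.height_add_one_le_of_lt_of_isPrime hlt

theorem le_height_of_span_le
    (hht : ∀ p ∈ (Ideal.span (Set.range f)).minimalPrimes, p.height = c)
    (hreg : ∀ i j x, α i * x ∈ Ideal.span (α '' {i' | i'.val < i.val}) →
      ∃ n : ℕ, f j ^ n * x ∈ Ideal.span (α '' {i' | i'.val < i.val}))
    {n : ℕ} (hn : n ≤ c) {Q : Ideal R} [Q.IsPrime] (hQ : Ideal.span (α '' {i | i.val < n}) ≤ Q) :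
    n ≤ Q.height := by
  by_cases h : Ideal.span (Set.range f) ≤ Q
  · obtain ⟨p, hp, hpQ⟩ := Ideal.exists_minimalPrimes_le h
    exact (Nat.cast_le.mpr hn).trans ((hht p hp).ge.trans (Ideal.height_mono hpQ))
  · rw [Ideal.span_le, Set.range_subset_iff] at h
    push Not at h
    exact le_height_of_notMem hreg hn hQ h.choose_spec

variable (hR : ∀ (Q : Ideal R) [Q.IsPrime], IsRegularLocalRing (Localization.AtPrime Q))
  (hht : ∀ p ∈ (Ideal.span (Set.range f)).minimalPrimes, p.height = c)
  (hreg : ∀ i j x, α i * x ∈ Ideal.span (α '' {i' | i'.val < i.val}) →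
      ∃ n : ℕ, f j ^ n * x ∈ Ideal.span (α '' {i' | i'.val < i.val}))

include hR hht hreg

theorem isWeaklyRegular_take_ofFn {n : ℕ} (hn : n ≤ c) :
    IsWeaklyRegular R ((List.ofFn α).take n) := by
  induction n with
  | zero => simp
  | succ n ih =>
    have hn' : n < (List.ofFn α).length := by simpa using hn
    rw [← List.take_concat_get' _ _ hn', isWeaklyRegular_append_iff]
    refine ⟨ih (n.le_succ.trans hn), ?_⟩
    rw [isWeaklyRegular_cons_iff]
    refine ⟨?_, .nil _ _⟩
    rw [isSMulRegular_iff_right_eq_zero_of_smul]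
    intro x hx
    obtain ⟨x, rfl⟩ := Submodule.Quotient.mk_surjective _ x
    rw [← Submodule.Quotient.mk_smul, Submodule.Quotient.mk_eq_zero, smul_eq_mul, smul_eq_mul,
      Ideal.mul_top, List.getElem_ofFn] at hx
    rw [Submodule.Quotient.mk_eq_zero, smul_eq_mul, Ideal.mul_top]
    by_contra hxJ
    obtain ⟨Q, hQ, ⟨y, hy⟩, hxQ⟩ := exists_isPrime_forall_mem_iff_of_notMem hxJ
    have := hR Q
    have hle := height_le_length_of_mem_associatedPrimes Q _ (ih (n.le_succ.trans hn)) y hy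
    have hge : ((n + 1 : ℕ) : ℕ∞) ≤ Q.height := le_height_of_span_le hht hreg hn <| by
      rw [Ideal.span_le, Set.image_subset_iff]
      intro i hi
      rcases (Nat.lt_succ_iff_lt_or_eq.mp hi) with h | h
      · refine (hy _).mpr (Ideal.mul_mem_right _ _ ?_)
        rw [Ideal.ofList_take_ofFn]
        exact Ideal.subset_span ⟨i, h, rfl⟩
      · obtain rfl : i = ⟨n, hn⟩ := Fin.ext h
        exact hxQ _ hx
    have := hge.trans hle
    simp only [List.length_take, List.length_ofFn, Nat.cast_le] at this
    omega

theorem isWeaklyRegular_ofFn : IsWeaklyRegular R (List.ofFn α) := by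
  simpa only [List.take_of_length_le, List.length_ofFn, le_refl] using
    isWeaklyRegular_take_ofFn hR hht hreg le_rfl

theorem height_le_of_forall_mem_iff {Q : Ideal R} [Q.IsPrime] {x : R}
    (hx : ∀ r, r ∈ Q ↔ r * x ∈ Ideal.span (Set.range α)) : Q.height ≤ c := by
  have := hR Q
  simpa using height_le_length_of_mem_associatedPrimes Q _
    (isWeaklyRegular_ofFn hR hht hreg) x (by simpa only [Ideal.ofList_ofFn] using hx)

omit hR in
theorem le_height_of_span_range_le {Q : Ideal R} [Q.IsPrime] (hQ : Ideal.span (Set.range α) ≤ Q) :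
    c ≤ Q.height :=
  le_height_of_span_le hht hreg le_rfl ((Ideal.span_mono (Set.image_subset_range _ _)).trans hQ)

theorem isRadical_span_range
    (hrad : ∀ j, ∀ x ∈ (Ideal.span (Set.range α)).radical,
      ∃ n : ℕ, f j ^ n * x ∈ Ideal.span (Set.range α))
    (hgen : ∀ p ∈ (Ideal.span (Set.range f)).minimalPrimes, ∀ x ∈ p,
      ∃ s ∉ p, s * x ∈ Ideal.span (Set.range α)) :
    (Ideal.span (Set.range α)).IsRadical := by
  intro x hx
  by_contra hxJ
  obtain ⟨Q, hQ, ⟨y, hy⟩, hxQ⟩ := exists_isPrime_forall_mem_iff_of_notMem hxJ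
  by_cases h : Ideal.span (Set.range f) ≤ Q
  · obtain ⟨p, hp, hpQ⟩ := Ideal.exists_minimalPrimes_le h
    have := hp.1.1
    obtain rfl : p = Q := Ideal.eq_of_le_of_height_le _ hpQ
      ((height_le_of_forall_mem_iff hR hht hreg hy).trans (hht p hp).ge)
    have hxp : x ∈ p := by
      obtain ⟨n, hn⟩ := hx
      exact hQ.mem_of_pow_mem n ((hy _).mpr (Ideal.mul_mem_right _ _ hn))
    obtain ⟨s, hs, hsx⟩ := hgen p hp x hxp
    exact hs (hxQ s hsx)
  · rw [Ideal.span_le, Set.range_subset_iff] at h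
    push Not at h
    obtain ⟨j, hj⟩ := h
    obtain ⟨n, hn⟩ := hrad j x hx
    exact hj (hQ.mem_of_pow_mem n (hxQ _ hn))

theorem mem_minimalPrimes_colon_and_height_eq [Fintype κ] {Q : Ideal R}
    (hQ : Q ∈ associatedPrimes R
      (R ⧸ (Ideal.span (Set.range α)).colon (Ideal.span (Set.range f)))) :
    Q ∈ ((Ideal.span (Set.range α)).colon (Ideal.span (Set.range f))).minimalPrimes ∧
      Q.height = c := by
  obtain ⟨hQp, x, hx⟩ := mem_associatedPrimes_quotient_iff.mp hQ
  have hmem (r : R) : r ∈ Q ↔ ∀ j, r * (x * f j) ∈ Ideal.span (Set.range α) := by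
    rw [hx, Ideal.colon_span, Submodule.mem_colon]
    simp [mul_assoc]
  have hVQ : Ideal.span (Set.range α) ≤ Q := fun r hr ↦
    (hmem r).mpr fun j ↦ Ideal.mul_mem_right _ _ hr
  have hle : Q.height ≤ c := by
    obtain ⟨j, -, hj⟩ := hQp.inf_le'.mp (show Finset.univ.inf
        (fun j ↦ (Ideal.span (Set.range α)).colon {x * f j}) ≤ Q from fun r hr ↦ by
      simpa [hmem, Submodule.mem_finsetInf, Submodule.mem_colon_singleton] using hr)
    refine height_le_of_forall_mem_iff hR hht hreg (x := x * f j) fun r ↦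
      ⟨fun hr ↦ (hmem r).mp hr j, fun hr ↦ hj ?_⟩
    simpa [Submodule.mem_colon_singleton] using hr
  refine ⟨⟨⟨hQp, fun r hr ↦ (hx r).mpr (Ideal.mul_mem_right _ _ hr)⟩, fun Q' hQ' hQQ' ↦ ?_⟩,
    hle.antisymm (le_height_of_span_range_le hht hreg hVQ)⟩
  have := hQ'.1
  exact (Ideal.eq_of_le_of_height_le _ hQQ' (hle.trans (le_height_of_span_range_le hht hreg
    ((Ideal.le_colon).trans hQ'.2)))).ge

end

section

variable {R : Type*} [CommRing R] {I J : Ideal R}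

theorem Ideal.IsRadical.colon (hI : I.IsRadical) : (I.colon J).IsRadical := by
  rintro r ⟨n, hn⟩
  rw [Submodule.mem_colon] at hn ⊢
  refine fun y hy ↦ hI ⟨n + 1, ?_⟩
  rw [smul_eq_mul, mul_pow, pow_succ, pow_succ']
  convert! I.mul_mem_right (r * y ^ n) (hn y hy) using 1
  rw [smul_eq_mul]
  ring

theorem Ideal.IsRadical.eq_inf_colon (hI : I.IsRadical) (hIJ : I ≤ J) : I = J ⊓ I.colon J := by
  refine le_antisymm (le_inf hIJ Ideal.le_colon) fun x ⟨hxJ, hx⟩ ↦ hI ⟨2, ?_⟩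
  rw [pow_two]
  exact Submodule.mem_colon.mp hx x hxJ

end

end

/-- **Generic link via general scalar matrices (Situation B), statement (1).**
Let `R` be an integral domain which is a smooth finitely generated `ℂ`-algebra,
and `I_X ⊊ R` a radical ideal generated by `f 1, …, f t` all of whose minimal primes
have height `c ≥ 1`.  Then there is a nonzero polynomial `P` in the `c × t` matrix
entries such that for every scalar matrix `a` with `P a ≠ 0`, setting
`αᵢ = Σⱼ a i j • f j`, `I_V = (α₁, …, α_c)` and `I_Y = (I_V : I_X)`:
if `I_Y ≠ R` then `α₁, …, α_c` is a regular sequence, `I_Y` is radical, every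
associated prime of `R ⧸ I_Y` is a minimal prime over `I_Y` of height `c`, and
`I_V = I_X ∩ I_Y`. -/
theorem generic_link_scalar_specialization
    (R : Type) [CommRing R] [IsDomain R] [Algebra ℂ R] [Algebra.Smooth ℂ R]
    (c t : ℕ) (hc : 1 ≤ c) (f : Fin t → R) (IX : Ideal R)
    (hIX : IX = Ideal.span (Set.range f))
    (hIXne : IX ≠ ⊤) (hIXrad : IX.IsRadical)
    (hIXht : ∀ p, (hp : p ∈ IX.minimalPrimes) →
      Order.height (⟨p, hp.1.1⟩ : PrimeSpectrum R) = (c : ℕ∞)) :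
    ∃ P : MvPolynomial (Fin c × Fin t) ℂ, P ≠ 0 ∧
      ∀ a : Fin c → Fin t → ℂ,
        MvPolynomial.eval (fun ij => a ij.1 ij.2) P ≠ 0 →
        ∀ α : Fin c → R, (∀ i, α i = ∑ j, a i j • f j) →
        ∀ IV IY : Ideal R,
          IV = Ideal.span (Set.range α) → IY = IV.colon IX → IY ≠ ⊤ →
          RingTheory.Sequence.IsRegular R (List.ofFn α) ∧
          IY.IsRadical ∧
          (∀ q ∈ associatedPrimes R (R ⧸ IY), ∃ hq : q ∈ IY.minimalPrimes,
            Order.height (⟨q, hq.1.1⟩ : PrimeSpectrum R) = (c : ℕ∞)) ∧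
          IV = IX ⊓ IY := by
  subst hIX
  have hN : IsNoetherianRing R := Algebra.FiniteType.isNoetherianRing ℂ R
  have hR (Q : Ideal R) [Q.IsPrime] : IsRegularLocalRing (Localization.AtPrime Q) :=
    isRegularLocalRing_localization_of_smooth ℂ Q
  have hht (p) (hp : p ∈ (Ideal.span (Set.range f)).minimalPrimes) : p.height = c :=
    (PrimeSpectrum.height_eq_orderHeight ⟨p, hp.1.1⟩).trans (hIXht p hp)
  have : Finite (Ideal.span (Set.range f)).minimalPrimes :=
    Ideal.finite_minimalPrimes_of_isNoetherianRing R _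
  obtain ⟨P₁, hP₁, h₁⟩ := exists_forall_of_finite fun ij : Fin c × Fin t ↦
    exists_forall_pow_mul_mem_of_mul_mem f {i' : Fin c | i'.val < ij.1.val} ij.2 (i := ij.1)
      (by simp)
  obtain ⟨P₂, hP₂, h₂⟩ := exists_forall_of_finite fun j : Fin t ↦
    exists_forall_pow_mul_mem_of_mem_radical f (Set.univ : Set (Fin c)) j
  obtain ⟨P₃, hP₃, h₃⟩ := exists_forall_of_finite
    fun p : (Ideal.span (Set.range f)).minimalPrimes ↦
      have := p.2.1.1
      have := hR p.1
      exists_forall_mul_mem_span_range_sum_smul (k := ℂ) p.1 (hht p p.2) f hIXrad p.2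
  refine ⟨P₁ * P₂ * P₃, mul_ne_zero (mul_ne_zero hP₁ hP₂) hP₃, ?_⟩
  rintro a ha α hα _ _ rfl rfl -
  simp only [map_mul, mul_ne_zero_iff] at ha
  obtain ⟨⟨ha₁, ha₂⟩, ha₃⟩ := ha
  have hα' : rowCombination f (fun ij ↦ a ij.1 ij.2) = α := funext fun i ↦ (hα i).symm
  have h₁ := h₁ _ ha₁
  have h₂ := h₂ _ ha₂
  have h₃ := h₃ _ ha₃
  simp only [hα', Set.image_univ] at h₁ h₂
  simp only [← hα] at h₃
  have hreg (i : Fin c) (j : Fin t) := h₁ (i, j)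
  have hVX : Ideal.span (Set.range α) ≤ Ideal.span (Set.range f) := by
    rw [Ideal.span_le, Set.range_subset_iff]
    intro i
    rw [hα]
    exact Ideal.sum_mem _ fun j _ ↦ Submodule.smul_of_tower_mem _ _
      (Ideal.subset_span (Set.mem_range_self j))
  have hVrad := isRadical_span_range hR hht hreg h₂ fun p hp ↦ h₃ ⟨p, hp⟩
  refine ⟨⟨isWeaklyRegular_ofFn hR hht hreg, fun h ↦ hIXne ?_⟩, hVrad.colon, fun q hq ↦ ?_,
    hVrad.eq_inf_colon hVX⟩
  · rw [smul_eq_mul, Ideal.mul_top, Ideal.ofList_ofFn] at h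
    exact top_le_iff.mp (h.trans_le hVX)
  · obtain ⟨hq, hqht⟩ := mem_minimalPrimes_colon_and_height_eq hR hht hreg hq
    exact ⟨hq, (PrimeSpectrum.height_eq_orderHeight ⟨q, hq.1.1⟩).symm.trans hqht⟩
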